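/- arXiv:1907.10970 — 2 statements merged into one kernel-verified Lean document; each statement's English description precedes it below -/
import Mathlib

section
/- Let p ≥ 2, g ≥ p+1, n ≥ 2 be integers and ε ∈ {0,1}, and assume 2g ≤ n−1+ε and (2p−2)(2n−2) > (2g−ε)². Then for every integer n′ ≥ n + 1 + g there exists a positive integer m with (g − ε/2 + √((g − ε/2)² − 4(p−1)))/(2(p−1)) ≤ m ≤ 2(n′−1)/(2g−ε) (inequalities of real numbers). -/
/-- **Proposition of Section 5.2.**  Let `p ≥ 2`, `g ≥ p+1`, `n ≥ 2` be integers
and `ε ∈ {0,1}`, with `2g ≤ n−1+ε` and `(2p−2)(2n−2) > (2g−ε)²`.  Then for every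
integer `n′ ≥ n + 1 + g` there exists a positive integer `m` with
`(g − ε/2 + √((g − ε/2)² − 4(p−1)))/(2(p−1)) ≤ m ≤ 2(n′−1)/(2g−ε)`
(as real numbers). -/
theorem exists_m_for_large_n'
    (p g n ε : ℤ) (hp : 2 ≤ p) (hg : p + 1 ≤ g) (hn : 2 ≤ n)
    (hε : ε = 0 ∨ ε = 1)
    (hgn : 2 * g ≤ n - 1 + ε)
    (hpos : (2 * g - ε) ^ 2 < (2 * p - 2) * (2 * n - 2)) :
    ∀ n' : ℤ, n + 1 + g ≤ n' →
      ∃ m : ℤ, 0 < m ∧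
        ((g : ℝ) - (ε : ℝ) / 2 +
            Real.sqrt (((g : ℝ) - (ε : ℝ) / 2) ^ 2 - 4 * ((p : ℝ) - 1))) /
          (2 * ((p : ℝ) - 1)) ≤ (m : ℝ) ∧
        (m : ℝ) ≤ 2 * ((n' : ℝ) - 1) / (2 * (g : ℝ) - (ε : ℝ)) := by
  intro n' hn'
  have hε0 : (0:ℝ) ≤ (ε:ℝ) := by rcases hε with h | h <;> simp [h]
  have hε1 : (ε:ℝ) ≤ 1 := by rcases hε with h | h <;> simp [h]
  have hpR : (2:ℝ) ≤ p := by exact_mod_cast hp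
  have hgR : (p:ℝ) + 1 ≤ g := by exact_mod_cast hg
  have hnR : (n:ℝ) + 1 + g ≤ n' := by exact_mod_cast hn'
  have hposR : (2 * (g:ℝ) - ε) ^ 2 < (2 * p - 2) * (2 * n - 2) := by exact_mod_cast hpos
  have ha : 0 < 2 * (g:ℝ) - ε := by linarith
  have hP : 0 < 2 * ((p:ℝ) - 1) := by linarith
  have hs : Real.sqrt (((g : ℝ) - (ε : ℝ) / 2) ^ 2 - 4 * ((p : ℝ) - 1)) ≤ (g:ℝ) - ε / 2 := by
    apply Real.sqrt_le_iff.mpr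
    constructor <;> linarith
  have h1 : ((g : ℝ) - (ε : ℝ) / 2 +
            Real.sqrt (((g : ℝ) - (ε : ℝ) / 2) ^ 2 - 4 * ((p : ℝ) - 1))) /
          (2 * ((p : ℝ) - 1)) ≤ (2 * (g:ℝ) - ε) / (2 * ((p : ℝ) - 1)) := by
    apply div_le_div_of_nonneg_right _ hP.le
    linarith
  have h0 : 0 < (2 * (g:ℝ) - ε) / (2 * ((p : ℝ) - 1)) := div_pos ha hP
  have h2 : (2 * (g:ℝ) - ε) / (2 * ((p : ℝ) - 1)) < (2 * n - 2) / (2 * (g:ℝ) - ε) := by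
    rw [div_lt_div_iff₀ hP ha]
    nlinarith
  have h3 : (2 * (n:ℝ) - 2) / (2 * (g:ℝ) - ε) + 1 ≤
      2 * ((n' : ℝ) - 1) / (2 * (g : ℝ) - (ε : ℝ)) := by
    rw [div_add_one ha.ne']
    apply div_le_div_of_nonneg_right _ ha.le
    linarith
  have h4 := Int.lt_floor_add_one (2 * ((n' : ℝ) - 1) / (2 * (g : ℝ) - (ε : ℝ)))
  refine ⟨⌊2 * ((n' : ℝ) - 1) / (2 * (g : ℝ) - (ε : ℝ))⌋, ?_, ?_, Int.floor_le _⟩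
  · have : (0:ℝ) < (⌊2 * ((n' : ℝ) - 1) / (2 * (g : ℝ) - (ε : ℝ))⌋ : ℤ) := by linarith
    exact_mod_cast this
  · linarith
end

section
/- Let n, p, g be integers and ε ∈ {0,1} with 2 ≤ n ≤ 13, p ≥ 2, g ≥ p+1, 2g ≤ n−1+ε, and (2p−2)(2n−2) > (2g−ε)². Then there exists a positive integer m such that, setting g′ = ⌈m(2g−ε)/2⌉, one has g′ + 1 ≤ n and g′ ≤ m²(p−1) + 1. -/
/-- **Arithmetic content of Theorem 5.5 (thm:nleq13).**  Let `n, p, g` be integers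
and `ε ∈ {0,1}` with `2 ≤ n ≤ 13`, `p ≥ 2`, `g ≥ p+1`, `2g ≤ n−1+ε`, and
`(2p−2)(2n−2) > (2g−ε)²`.  Then there exists a positive integer `m` such that,
setting `g′ = ⌈m(2g−ε)/2⌉`, one has `g′ + 1 ≤ n` and `g′ ≤ m²(p−1) + 1`. -/
theorem exists_multiple_nleq13
    (n p g ε : ℤ) (hn : 2 ≤ n) (hn' : n ≤ 13)
    (hp : 2 ≤ p) (hg : p + 1 ≤ g)
    (hε : ε = 0 ∨ ε = 1)
    (hgn : 2 * g ≤ n - 1 + ε)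
    (hpos : (2 * g - ε) ^ 2 < (2 * p - 2) * (2 * n - 2)) :
    ∃ m : ℤ, 0 < m ∧
      ⌈((m : ℚ) * (2 * (g : ℚ) - (ε : ℚ))) / 2⌉ + 1 ≤ n ∧
      ⌈((m : ℚ) * (2 * (g : ℚ) - (ε : ℚ))) / 2⌉ ≤ m ^ 2 * (p - 1) + 1 := by
  have key : ∀ m z : ℤ, m * (2 * g - ε) ≤ 2 * z →
      ⌈((m : ℚ) * (2 * (g : ℚ) - (ε : ℚ))) / 2⌉ ≤ z := by
    intro m z h
    rw [Int.ceil_le]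
    have h' : (m : ℚ) * (2 * (g : ℚ) - (ε : ℚ)) ≤ 2 * (z : ℚ) := by exact_mod_cast h
    linarith
  by_cases h2 : 2 * g - ε ≤ 4 * (p - 1) + 1
  · -- `m = 2` works
    refine ⟨2, by norm_num, ?_, key 2 _ (by linarith)⟩
    have := key 2 (n - 1) (by linarith)
    linarith
  · -- only `p = 2`, `2g - ε = 6`, `n ≥ 11` remains, and `m = 3` works
    have hp3 : p ≤ 3 := by omega
    have hg6 : g ≤ 6 := by omega
    have hmain : p = 2 ∧ 2 * g - ε = 6 ∧ 11 ≤ n := by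
      have hg3 : 3 ≤ g := by omega
      rcases hε with rfl | rfl <;> interval_cases p <;> interval_cases g <;> omega
    obtain ⟨rfl, h6, h11⟩ := hmain
    refine ⟨3, by norm_num, ?_, key 3 _ (by rw [h6]; norm_num)⟩
    have := key 3 (n - 1) (by rw [h6]; linarith)
    linarith
end
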